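/- Let 𝒯 be a hierarchy on a nonempty finite set X and f : 𝒯 → ℝ a score function. Define recursively on strict inclusion: P*(C) = {C} if C is minimal; otherwise, letting C₁, …, C_k be the children of C, P*(C) = {C} if f(C) ≥ min_i F*(C_i) and P*(C) = ⋃_i P*(C_i) otherwise, where F*(C) denotes min_{D ∈ P*(C)} f(D). Then P*(X) is a tree-consistent segmentation of X, and it maximizes F_min(P) = min_{D∈P} f(D) over all tree-consistent segmentations P of X with respect to 𝒯. -/

import Mathlib

variable {α : Type*}

/-- The children of `C` in the family `T`: the maximal members of `T` strictly
contained in `C`. -/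
def children [DecidableEq α] (T : Finset (Finset α)) (C : Finset α) :
    Finset (Finset α) :=
  T.filter fun D => D ⊂ C ∧ ∀ E ∈ T, ¬(D ⊂ E ∧ E ⊂ C)

/-- A hierarchy on a nonempty finite set `X`: a finite laminar family of nonempty
subsets of `X` containing the root `X`, in which the children of every non-minimal
member `C` (the maximal members strictly contained in `C`) form a partition of `C`. -/
structure Hierarchy (α : Type*) [DecidableEq α] (X : Finset α) where
  T : Finset (Finset α)
  root_mem : X ∈ T
  root_nonempty : X.Nonempty
  mem_nonempty : ∀ C ∈ T, C.Nonempty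
  mem_subset : ∀ C ∈ T, C ⊆ X
  laminar : ∀ C ∈ T, ∀ D ∈ T, Disjoint C D ∨ C ⊆ D ∨ D ⊆ C
  children_disjoint : ∀ C ∈ T, (∃ D ∈ T, D ⊂ C) →
    ∀ D₁ ∈ children T C, ∀ D₂ ∈ children T C, D₁ ≠ D₂ → Disjoint D₁ D₂
  children_cover : ∀ C ∈ T, (∃ D ∈ T, D ⊂ C) → (children T C).biUnion id = C

/-- The sub-hierarchy of `T` at `C`: all members of `T` contained in `C`. -/
def subHier [DecidableEq α] (T : Finset (Finset α)) (C : Finset α) :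
    Finset (Finset α) :=
  T.filter fun D => D ⊆ C

/-- A tree-consistent segmentation of `C` with respect to the family `T`: a subfamily
`P ⊆ T` whose members are pairwise disjoint and whose union is `C`. -/
def IsSeg [DecidableEq α] (T : Finset (Finset α)) (C : Finset α)
    (P : Finset (Finset α)) : Prop :=
  P ⊆ T ∧ (∀ D₁ ∈ P, ∀ D₂ ∈ P, D₁ ≠ D₂ → Disjoint D₁ D₂) ∧ P.biUnion id = C

/-- Algorithm 1 (`OptMinSeg`): `P*(C) = {C}` if `C` is minimal; otherwise, with
children `C₁, …, C_k`, `P*(C) = {C}` if `f C ≥ minᵢ F*(Cᵢ)` and `P*(C) = ⋃ᵢ P*(Cᵢ)`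
otherwise, where `F*(Cᵢ) = min_{D ∈ P*(Cᵢ)} f D` (written below as `sInf` of the image
of the nonempty finite set `P*(Cᵢ)` under `f`). -/
noncomputable def OptSeg [DecidableEq α] (T : Finset (Finset α)) (f : Finset α → ℝ) :
    Finset α → Finset (Finset α) := fun C =>
  if hc : (children T C).Nonempty then
    if ((children T C).attach.inf' (by simpa using hc) fun D =>
          sInf (f '' ↑(OptSeg T f D.1))) ≤ f C then
      {C}
    else
      (children T C).attach.biUnion fun D => OptSeg T f D.1
  else {C}
termination_by C => C.card
decreasing_by
  all_goals exact Finset.card_lt_card (Finset.mem_filter.mp D.2).2.1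

section Children

variable [DecidableEq α] {T : Finset (Finset α)} {C D : Finset α}

theorem mem_children :
    D ∈ children T C ↔ D ∈ T ∧ D ⊂ C ∧ ∀ E ∈ T, ¬(D ⊂ E ∧ E ⊂ C) :=
  Finset.mem_filter

theorem exists_child_of_ssubset (hD : D ∈ T) (hDC : D ⊂ C) :
    ∃ E ∈ children T C, D ⊆ E := by
  obtain ⟨E, hDE, hE⟩ := (T.filter (· ⊂ C)).exists_le_maximal
    (Finset.mem_filter.mpr ⟨hD, hDC⟩)
  have hE' := Finset.mem_filter.mp hE.prop
  exact ⟨E, mem_children.mpr ⟨hE'.1, hE'.2, fun F hF h =>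
    hE.not_gt (Finset.mem_filter.mpr ⟨hF, h.2⟩) h.1⟩, hDE⟩

end Children

section Segmentation

variable [DecidableEq α] {T : Finset (Finset α)} {C D : Finset α} {P : Finset (Finset α)}

theorem IsSeg.subset_of_mem (h : IsSeg T C P) (hD : D ∈ P) : D ⊆ C :=
  (Finset.subset_biUnion_of_mem id hD).trans h.2.2.le

theorem IsSeg.nonempty (h : IsSeg T C P) (hC : C.Nonempty) : P.Nonempty :=
  (Finset.biUnion_nonempty.mp (h.2.2.symm ▸ hC)).imp fun _ hD => hD.1

theorem isSeg_singleton (hC : C ∈ T) : IsSeg T C {C} := by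
  simp [IsSeg, hC]

theorem IsSeg.biUnion_children {Q : Finset α → Finset (Finset α)}
    (hdisj : ∀ D ∈ children T C, ∀ E ∈ children T C, D ≠ E → Disjoint D E)
    (hcover : (children T C).biUnion id = C)
    (hQ : ∀ D ∈ children T C, IsSeg T D (Q D)) :
    IsSeg T C ((children T C).biUnion Q) := by
  refine ⟨Finset.biUnion_subset.mpr fun D hD => (hQ D hD).1, ?_, ?_⟩
  · intro A hA B hB hAB
    obtain ⟨D, hD, hAD⟩ := Finset.mem_biUnion.mp hA
    obtain ⟨E, hE, hBE⟩ := Finset.mem_biUnion.mp hB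
    by_cases hDE : D = E
    · subst hDE
      exact (hQ D hD).2.1 A hAD B hBE hAB
    · exact (hdisj D hD E hE hDE).mono ((hQ D hD).subset_of_mem hAD)
        ((hQ E hE).subset_of_mem hBE)
  · rw [Finset.biUnion_biUnion]
    conv_rhs => rw [← hcover]
    exact Finset.biUnion_congr rfl fun D hD => (hQ D hD).2.2

theorem IsSeg.restrict_child
    (hdisj : ∀ D ∈ children T C, ∀ E ∈ children T C, D ≠ E → Disjoint D E)
    (hP : IsSeg T C P) (hCP : C ∉ P) (hD : D ∈ children T C) :
    IsSeg T D (P.filter (· ⊆ D)) := by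
  refine ⟨(Finset.filter_subset _ _).trans hP.1, fun A hA B hB =>
    hP.2.1 A (Finset.mem_filter.mp hA).1 B (Finset.mem_filter.mp hB).1, ?_⟩
  refine Finset.Subset.antisymm
    (Finset.biUnion_subset.mpr fun A hA => (Finset.mem_filter.mp hA).2) fun x hx => ?_
  have hxC : x ∈ P.biUnion id := hP.2.2.symm ▸ (mem_children.mp hD).2.1.subset hx
  obtain ⟨A, hA, hxA⟩ := Finset.mem_biUnion.mp hxC
  have hAC : A ⊂ C := (hP.subset_of_mem hA).ssubset_of_ne fun h => hCP (h ▸ hA)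
  obtain ⟨E, hE, hAE⟩ := exists_child_of_ssubset (hP.1 hA) hAC
  have hED : E = D := by
    by_contra hne
    exact Finset.disjoint_left.mp (hdisj E hE D hD hne) (hAE hxA) hx
  exact Finset.mem_biUnion.mpr ⟨A, Finset.mem_filter.mpr ⟨hA, hED ▸ hAE⟩, hxA⟩

end Segmentation

theorem sInf_image_le_of_mem {β : Type*} {f : β → ℝ} {P : Finset β} {b : β} (hb : b ∈ P) :
    sInf (f '' ↑P) ≤ f b :=
  csInf_le (P.finite_toSet.image f).bddBelow (Set.mem_image_of_mem f hb)

section OptSeg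

variable [DecidableEq α] {T : Finset (Finset α)} {f : Finset α → ℝ} {C : Finset α}

theorem optSeg_of_children_eq_empty (h : children T C = ∅) : OptSeg T f C = {C} := by
  rw [OptSeg, dif_neg (by simp [h])]

theorem optSeg_of_children_nonempty (h : (children T C).Nonempty) :
    (OptSeg T f C = {C} ∧ ∃ D ∈ children T C, sInf (f '' ↑(OptSeg T f D)) ≤ f C) ∨
      (OptSeg T f C = (children T C).biUnion (OptSeg T f) ∧
        ∀ D ∈ children T C, ∀ E ∈ OptSeg T f D, f C < f E) := by
  rw [OptSeg, dif_pos h]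
  split_ifs with hle
  · obtain ⟨D, -, hD⟩ := (Finset.inf'_le_iff _).mp hle
    exact Or.inl ⟨rfl, D.1, D.2, hD⟩
  · refine Or.inr ⟨?_, fun D hD E hE => ?_⟩
    · ext A
      simp
    · rw [not_le, Finset.lt_inf'_iff] at hle
      exact (hle ⟨D, hD⟩ (Finset.mem_attach _ _)).trans_le (sInf_image_le_of_mem hE)

theorem Hierarchy.isSeg_optSeg {X : Finset α} (H : Hierarchy α X) (f : Finset α → ℝ)
    (hC : C ∈ H.T) : IsSeg H.T C (OptSeg H.T f C) := by
  induction C using Finset.strongInduction with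
  | H C ih =>
    rcases (children H.T C).eq_empty_or_nonempty with h | h
    · rw [optSeg_of_children_eq_empty h]
      exact isSeg_singleton hC
    · rcases optSeg_of_children_nonempty (f := f) h with ⟨hO, -⟩ | ⟨hO, -⟩ <;> rw [hO]
      · exact isSeg_singleton hC
      · have hex : ∃ D ∈ H.T, D ⊂ C :=
          h.imp fun D hD => ⟨(mem_children.mp hD).1, (mem_children.mp hD).2.1⟩
        exact .biUnion_children (H.children_disjoint C hC hex) (H.children_cover C hC hex)
          fun D hD => ih D (mem_children.mp hD).2.1 (mem_children.mp hD).1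

theorem Hierarchy.le_of_mem_optSeg {X : Finset α} (H : Hierarchy α X) (hC : C ∈ H.T)
    {P : Finset (Finset α)} (hP : IsSeg H.T C P) {t : ℝ} (ht : ∀ D ∈ P, t ≤ f D) :
    ∀ D ∈ OptSeg H.T f C, t ≤ f D := by
  induction C using Finset.strongInduction generalizing P with
  | H C ih =>
    rcases (children H.T C).eq_empty_or_nonempty with h | h
    · obtain ⟨D, hD⟩ := hP.nonempty (H.mem_nonempty C hC)
      have hDC : D = C := by
        by_contra hne
        obtain ⟨E, hE, -⟩ := exists_child_of_ssubset (hP.1 hD)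
          ((hP.subset_of_mem hD).ssubset_of_ne hne)
        simp [h] at hE
      subst hDC
      simpa [optSeg_of_children_eq_empty h] using ht D hD
    · have hex : ∃ D ∈ H.T, D ⊂ C :=
        h.imp fun D hD => ⟨(mem_children.mp hD).1, (mem_children.mp hD).2.1⟩
      have hchild (hCP : C ∉ P) : ∀ D ∈ children H.T C, ∀ E ∈ OptSeg H.T f D, t ≤ f E :=
        fun D hD => ih D (mem_children.mp hD).2.1 (mem_children.mp hD).1
          (hP.restrict_child (H.children_disjoint C hC hex) hCP hD)
          fun E hE => ht E (Finset.mem_filter.mp hE).1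
      rcases optSeg_of_children_nonempty (f := f) h with ⟨hO, D, hD, hDC⟩ | ⟨hO, hlt⟩ <;> rw [hO]
      · simp only [Finset.mem_singleton, forall_eq]
        by_cases hCP : C ∈ P
        · exact ht C hCP
        · have hDT := (mem_children.mp hD).1
          have hne := (H.isSeg_optSeg f hDT).nonempty (H.mem_nonempty D hDT)
          refine (le_csInf (hne.to_set.image f) ?_).trans hDC
          rintro _ ⟨E, hE, rfl⟩
          exact hchild hCP D hD E hE
      · intro E hE
        obtain ⟨D, hD, hED⟩ := Finset.mem_biUnion.mp hE
        by_cases hCP : C ∈ P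
        · exact (ht C hCP).trans (hlt D hD E hED).le
        · exact hchild hCP D hD E hED

end OptSeg

/-- **Theorem 1.** The segmentation `P*(X)` returned by Algorithm 1 is a
tree-consistent segmentation of the root `X` of the hierarchy `𝒯`, and it maximizes
the worst-case score `F_min(P) = min_{D ∈ P} f D` over all tree-consistent
segmentations `P` of `X` with respect to `𝒯`. -/
theorem optSeg_isOptimal [DecidableEq α] {X : Finset α} (H : Hierarchy α X)
    (f : Finset α → ℝ) :
    ∃ hseg : IsSeg H.T X (OptSeg H.T f X),
      ∀ (P : Finset (Finset α)) (hP : P.Nonempty), IsSeg H.T X P →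
        P.inf' hP f ≤
          (OptSeg H.T f X).inf'
            (by
              obtain ⟨-, -, hU⟩ := hseg
              obtain ⟨x, hx⟩ := H.root_nonempty
              rw [← hU] at hx
              obtain ⟨D, hD, -⟩ := Finset.mem_biUnion.mp hx
              exact ⟨D, hD⟩) f := by
  exact ⟨H.isSeg_optSeg f H.root_mem, fun P _ hseg => Finset.le_inf' _ _
    (H.le_of_mem_optSeg H.root_mem hseg fun _ hD => Finset.inf'_le f hD)⟩
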